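/- Let μ, α, β, σ > 0, r ≥ 1, let y : ℝ → ℝ be continuous, let f : ℝ × ℝ³ → ℝ³ be continuous with ∫_{ℝ³}|f(t,x)|² dx < ∞ for every t, let u : ℝ × ℝ³ → ℝ³ be smooth with, for each bounded time interval, a single compact set K ⊂ ℝ³ containing the support of u(t,·) for all t in that interval, let u(t,·) be divergence-free (∑_{i=1}^{3} ∂uᵢ/∂xᵢ ≡ 0) for every t, and let p : ℝ × ℝ³ → ℝ be continuously differentiable in x. Assume the equation ∂u/∂t − μΔu + e^{y(t)}(u·∇)u + αu + βe^{(r−1)y(t)}|u|^{r−1}u = −e^{−y(t)}∇p + e^{−y(t)}f + σ y(t) u holds pointwise on ℝ × ℝ³. Then the function E(t) := ∫_{ℝ³}|u(t,x)|² dx is differentiable and for every t: E′(t) + (3α/2 − 2σ y(t)) E(t) + 2μ ∫_{ℝ³}|∇u(t,x)|² dx + 2β e^{(r−1)y(t)} ∫_{ℝ³}|u(t,x)|^{r+1} dx ≤ (2/α) e^{2|y(t)|} ∫_{ℝ³}|f(t,x)|² dx. -/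

import Mathlib

open MeasureTheory Filter

noncomputable section

/-- ℝ³ as a Euclidean space. -/
abbrev E3 : Type := EuclideanSpace ℝ (Fin 3)

/-- Partial derivative `∂g/∂xᵢ` of a scalar function on ℝ³. -/
def pd (i : Fin 3) (g : E3 → ℝ) (x : E3) : ℝ :=
  fderiv ℝ g x (EuclideanSpace.single i 1)

/-- The Laplacian of a scalar function on ℝ³. -/
def lap (g : E3 → ℝ) (x : E3) : ℝ :=
  ∑ i : Fin 3, pd i (fun y => pd i g y) x

/-- `|∇v|² = ∑_{i,j} (∂vⱼ/∂xᵢ)²` for a vector field on ℝ³. -/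
def gradSq (v : E3 → E3) (x : E3) : ℝ :=
  ∑ i : Fin 3, ∑ j : Fin 3, (pd i (fun y => v y j) x) ^ 2

theorem pd_add {i : Fin 3} {g h : E3 → ℝ} (hg : Differentiable ℝ g) (hh : Differentiable ℝ h)
    (x : E3) : pd i (fun z => g z + h z) x = pd i g x + pd i h x := by
  simp [pd, fderiv_fun_add (hg x) (hh x)]

theorem pd_sub {i : Fin 3} {g h : E3 → ℝ} (hg : Differentiable ℝ g) (hh : Differentiable ℝ h)
    (x : E3) : pd i (fun z => g z - h z) x = pd i g x - pd i h x := by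
  simp [pd, fderiv_fun_sub (hg x) (hh x)]

theorem pd_mul {i : Fin 3} {g h : E3 → ℝ} (hg : Differentiable ℝ g) (hh : Differentiable ℝ h)
    (x : E3) : pd i (fun z => g z * h z) x = pd i g x * h x + g x * pd i h x := by
  simp [pd, fderiv_fun_mul (hg x) (hh x)]
  ring

theorem pd_const_mul {i : Fin 3} {g : E3 → ℝ} (hg : Differentiable ℝ g) (c : ℝ)
    (x : E3) : pd i (fun z => c * g z) x = c * pd i g x := by
  simp [pd, fderiv_const_mul (hg x) c]

theorem ContDiff.pd {n : ℕ} {g : E3 → ℝ} (hg : ContDiff ℝ (n + 1 : ℕ) g) (i : Fin 3) :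
    ContDiff ℝ n (_root_.pd i g) :=
  (hg.fderiv_right (m := n) (by simp)).clm_apply contDiff_const

theorem HasCompactSupport.pd {g : E3 → ℝ} (hg : HasCompactSupport g) (i : Fin 3) :
    HasCompactSupport (_root_.pd i g) :=
  hg.fderiv_apply ℝ _

theorem integrable_pd {g : E3 → ℝ} (hg : ContDiff ℝ 1 g) (hc : HasCompactSupport g) (i : Fin 3) :
    Integrable (pd i g) :=
  (hg.continuous_fderiv_apply one_ne_zero |>.comp
    (continuous_id.prodMk continuous_const)).integrable_of_hasCompactSupport (hc.pd i)

/-- The integral of a partial derivative of a compactly supported `C¹` function vanishes. -/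
theorem integral_pd_eq_zero {g : E3 → ℝ} (hg : ContDiff ℝ 1 g) (hc : HasCompactSupport g)
    (i : Fin 3) : ∫ x, pd i g x = 0 := by
  have h := integral_mul_fderiv_eq_neg_fderiv_mul_of_integrable (μ := (volume : Measure E3))
    (f := fun _ : E3 => (1 : ℝ)) (g := g) (v := EuclideanSpace.single i 1)
    (by simp) (by simp only [one_mul]; exact integrable_pd hg hc i)
    (by simpa using hg.continuous.integrable_of_hasCompactSupport hc)
    (fun _ _ => differentiableAt_const _)
    (fun x _ => hg.differentiable one_ne_zero x)
  simpa [pd] using h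

/-- Differentiation under the integral sign for `C¹` functions whose supports in the space
variable stay in a fixed compact set for nearby times. -/
theorem hasDerivAt_integral_of_contDiff_of_compact {G : ℝ → E3 → ℝ}
    (hG : ContDiff ℝ 1 (fun q : ℝ × E3 => G q.1 q.2)) {t : ℝ} {K : Set E3} (hK : IsCompact K)
    (hsupp : ∀ s ∈ Set.Icc (t - 1) (t + 1), ∀ x, x ∉ K → G s x = 0) :
    Integrable (fun x => deriv (fun s => G s x) t) ∧
      HasDerivAt (fun s => ∫ x, G s x) (∫ x, deriv (fun s => G s x) t) t := by
  have hline (s : ℝ) (x : E3) : HasDerivAt (fun s => G s x)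
      (fderiv ℝ (fun q : ℝ × E3 => G q.1 q.2) (s, x) (1, 0)) s :=
    HasFDerivAt.comp_hasDerivAt (f := fun s => (s, x)) s
      (hG.differentiable one_ne_zero (s, x)).hasFDerivAt
      ((hasDerivAt_id' s).prodMk (hasDerivAt_const s x))
  have hcont : Continuous (fun q : ℝ × E3 => deriv (fun s => G s q.2) q.1) := by
    have h : (fun q : ℝ × E3 => deriv (fun s => G s q.2) q.1) =
        fun q => fderiv ℝ (fun q : ℝ × E3 => G q.1 q.2) q (1, 0) :=
      funext fun q => (hline q.1 q.2).deriv
    rw [h]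
    exact (hG.continuous_fderiv one_ne_zero).clm_apply continuous_const
  obtain ⟨C, hC⟩ := ((isCompact_Icc (a := t - 1) (b := t + 1)).prod hK).exists_bound_of_continuousOn
    hcont.continuousOn
  have hslice (s : ℝ) : Continuous (G s) :=
    hG.continuous.comp (continuous_const.prodMk continuous_id)
  refine hasDerivAt_integral_of_dominated_loc_of_deriv_le (s := Set.Ioo (t - 1) (t + 1))
    (F' := fun s x => deriv (fun s => G s x) s)
    (bound := K.indicator fun _ => C) (Ioo_mem_nhds (by linarith) (by linarith))
    (Eventually.of_forall fun s => (hslice s).aestronglyMeasurable)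
    ((hslice t).integrable_of_hasCompactSupport
      (HasCompactSupport.intro hK (hsupp t ⟨by linarith, by linarith⟩)))
    (hcont.comp (continuous_const.prodMk continuous_id)).aestronglyMeasurable
    (ae_of_all _ fun x s hs => ?_)
    ((integrable_indicator_iff hK.measurableSet).2
      (integrableOn_const hK.measure_lt_top.ne))
    (ae_of_all _ fun x s _ => (hline s x).differentiableAt.hasDerivAt)
  by_cases hx : x ∈ K
  · rw [Set.indicator_of_mem hx]
    exact hC (s, x) ⟨Set.Ioo_subset_Icc_self hs, hx⟩
  · rw [Set.indicator_of_notMem hx]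
    have h0 : (fun s => G s x) =ᶠ[nhds s] fun _ => 0 := by
      filter_upwards [Ioo_mem_nhds hs.1 hs.2] with s' hs'
      exact hsupp s' (Set.Ioo_subset_Icc_self hs') x hx
    simp [h0.deriv_eq]

/-- Young's inequality for the forcing term. -/
theorem two_exp_neg_mul_le {α : ℝ} (hα : 0 < α) (c a b : ℝ) :
    2 * Real.exp (-c) * (a * b) ≤ α / 2 * a ^ 2 + 2 / α * Real.exp (2 * |c|) * b ^ 2 := by
  have h1 : Real.exp (-c) ^ 2 ≤ Real.exp (2 * |c|) := by
    rw [← Real.exp_nat_mul]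
    refine Real.exp_le_exp.2 ?_
    push_cast
    linarith [neg_le_abs c]
  have h2 : 2 * Real.exp (-c) * (a * b) ≤ α / 2 * a ^ 2 + 2 / α * Real.exp (-c) ^ 2 * b ^ 2 := by
    have h : α / 2 * a ^ 2 + 2 / α * Real.exp (-c) ^ 2 * b ^ 2 - 2 * Real.exp (-c) * (a * b)
        = α / 2 * (a - 2 / α * Real.exp (-c) * b) ^ 2 := by
      field_simp
      ring
    have : 0 ≤ α / 2 * (a - 2 / α * Real.exp (-c) * b) ^ 2 := by positivity
    linarith
  refine h2.trans ?_
  gcongr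

/-- The flux whose divergence collects the viscous, convective and pressure contributions to the
local energy balance. -/
def energyFlux (a b c : ℝ) (w : Fin 3 → E3 → ℝ) (P : E3 → ℝ) (i : Fin 3) (x : E3) : ℝ :=
  a * (w 0 x * pd i (w 0) x + w 1 x * pd i (w 1) x + w 2 x * pd i (w 2) x)
    - b * (w i x * (w 0 x * w 0 x + w 1 x * w 1 x + w 2 x * w 2 x)) - c * (w i x * P x)

theorem contDiff_energyFlux (a b c : ℝ) {w : Fin 3 → E3 → ℝ} {P : E3 → ℝ}
    (hw : ∀ j, ContDiff ℝ 2 (w j)) (hP : ContDiff ℝ 1 P) (i : Fin 3) :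
    ContDiff ℝ 1 (energyFlux a b c w P i) := by
  have hw1 (j : Fin 3) : ContDiff ℝ 1 (w j) := (hw j).of_le one_le_two
  have hd (j : Fin 3) : ContDiff ℝ 1 (pd i (w j)) := ContDiff.pd (n := 1) (hw j) i
  have := hw1 0
  have := hw1 1
  have := hw1 2
  have := hw1 i
  have := hd 0
  have := hd 1
  have := hd 2
  unfold energyFlux
  fun_prop

theorem pd_energyFlux (a b c : ℝ) {w : Fin 3 → E3 → ℝ} {P : E3 → ℝ}
    (hw : ∀ j, ContDiff ℝ 2 (w j)) (hP : ContDiff ℝ 1 P) (i : Fin 3) (x : E3) :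
    pd i (energyFlux a b c w P i) x =
      a * ∑ j, (pd i (w j) x ^ 2 + w j x * pd i (pd i (w j)) x)
        - b * (pd i (w i) x * ∑ j, w j x ^ 2 + 2 * w i x * ∑ j, w j x * pd i (w j) x)
        - c * (pd i (w i) x * P x + w i x * pd i P x) := by
  have hw1 (j : Fin 3) : Differentiable ℝ (w j) := (hw j).differentiable two_ne_zero
  have hd (j : Fin 3) : Differentiable ℝ (pd i (w j)) :=
    (ContDiff.pd (n := 1) (hw j) i).differentiable one_ne_zero
  have hP1 : Differentiable ℝ P := hP.differentiable one_ne_zero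
  have h0 := hw1 0
  have h1 := hw1 1
  have h2 := hw1 2
  have hi := hw1 i
  have hd0 := hd 0
  have hd1 := hd 1
  have hd2 := hd 2
  unfold energyFlux
  rw [pd_sub (by fun_prop) (by fun_prop), pd_sub (by fun_prop) (by fun_prop),
    pd_const_mul (by fun_prop), pd_const_mul (by fun_prop), pd_const_mul (by fun_prop),
    pd_add (by fun_prop) (by fun_prop), pd_add (by fun_prop) (by fun_prop),
    pd_mul h0 hd0, pd_mul h1 hd1, pd_mul h2 hd2, pd_mul hi (by fun_prop),
    pd_add (by fun_prop) (by fun_prop), pd_add (by fun_prop) (by fun_prop),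
    pd_mul h0 h0, pd_mul h1 h1, pd_mul h2 h2, pd_mul hi hP1]
  simp only [Fin.sum_univ_three]
  ring

/-- First energy inequality (3.5) of Lemma 3.1, for classical spatially compactly
supported solutions of the transformed 3D stochastic CBF equations with linear
multiplicative noise:
`E′(t) + (3α/2 − 2σy(t))E(t) + 2μ∫|∇u|² dx + 2βe^{(r−1)y(t)}∫|u|^{r+1} dx
  ≤ (2/α) e^{2|y(t)|} ∫|f|² dx`, where `E(t) = ∫|u(t)|² dx`. -/
theorem stmt14 (μ α β σ r : ℝ) (hμ : 0 < μ) (hα : 0 < α) (hβ : 0 < β) (hσ : 0 < σ)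
    (hr : 1 ≤ r)
    (y : ℝ → ℝ) (hy : Continuous y)
    (f : ℝ → E3 → E3) (hf : Continuous (Function.uncurry f))
    (hfL2 : ∀ t, Integrable (fun x : E3 => ‖f t x‖ ^ 2))
    (u : ℝ → E3 → E3)
    (hu : ContDiff ℝ (⊤ : ℕ∞) (fun q : ℝ × E3 => u q.1 q.2))
    (husupp : ∀ a b : ℝ, ∃ K : Set E3, IsCompact K ∧
      ∀ t ∈ Set.Icc a b, ∀ x : E3, x ∉ K → u t x = 0)
    (hudiv : ∀ t x, (∑ i : Fin 3, pd i (fun y' => u t y' i) x) = 0)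
    (p : ℝ → E3 → ℝ) (hp : ∀ t, ContDiff ℝ 1 (p t))
    (hpde : ∀ (t : ℝ) (x : E3) (j : Fin 3),
      deriv (fun s => u s x j) t - μ * lap (fun y' => u t y' j) x
        + Real.exp (y t) * (∑ i : Fin 3, u t x i * pd i (fun y' => u t y' j) x)
        + α * u t x j
        + β * Real.exp ((r - 1) * y t) * (‖u t x‖ ^ (r - 1) * u t x j)
      = -(Real.exp (-(y t)) * pd j (p t) x) + Real.exp (-(y t)) * f t x j
        + σ * y t * u t x j) :
    (∀ t : ℝ, DifferentiableAt ℝ (fun s => ∫ x : E3, ‖u s x‖ ^ 2) t) ∧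
    ∀ t : ℝ,
      deriv (fun s => ∫ x : E3, ‖u s x‖ ^ 2) t
        + (3 * α / 2 - 2 * σ * y t) * (∫ x : E3, ‖u t x‖ ^ 2)
        + 2 * μ * (∫ x : E3, gradSq (u t) x)
        + 2 * β * Real.exp ((r - 1) * y t) * (∫ x : E3, ‖u t x‖ ^ (r + 1))
      ≤ 2 / α * Real.exp (2 * |y t|) * ∫ x : E3, ‖f t x‖ ^ 2 := by
  have hu1 : ContDiff ℝ 1 (fun q : ℝ × E3 => ‖u q.1 q.2‖ ^ 2) :=
    (contDiff_infty.1 hu 1).norm_sq ℝ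
  have hE (t : ℝ) : Integrable (fun x => deriv (fun s => ‖u s x‖ ^ 2) t) ∧
      HasDerivAt (fun s => ∫ x : E3, ‖u s x‖ ^ 2) (∫ x, deriv (fun s => ‖u s x‖ ^ 2) t) t := by
    obtain ⟨K, hK, hKu⟩ := husupp (t - 1) (t + 1)
    exact hasDerivAt_integral_of_contDiff_of_compact (G := fun s x => ‖u s x‖ ^ 2) hu1 hK
      fun s hs x hx => by simp [hKu s hs x hx]
  refine ⟨fun t => (hE t).2.differentiableAt, fun t => ?_⟩
  obtain ⟨K, hK, hKu⟩ := husupp t t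
  have hut0 (x : E3) (hx : x ∉ K) : u t x = 0 := hKu t (by simp) x hx
  have hut : ContDiff ℝ 2 (u t) :=
    (contDiff_infty.1 hu 2).comp (contDiff_const.prodMk contDiff_id)
  set w : Fin 3 → E3 → ℝ := fun j x => u t x j with hw_def
  have hw (j : Fin 3) : ContDiff ℝ 2 (w j) := (contDiff_euclidean.1 hut) j
  have hwc (j : Fin 3) : HasCompactSupport (w j) :=
    HasCompactSupport.intro hK fun x hx => by simp [hw_def, hut0 x hx]
  set W := energyFlux (2 * μ) (Real.exp (y t)) (2 * Real.exp (-(y t))) w (p t) with hW_def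
  have hW (i : Fin 3) : ContDiff ℝ 1 (W i) := contDiff_energyFlux _ _ _ hw (hp t) i
  have hWc (i : Fin 3) : HasCompactSupport (W i) :=
    HasCompactSupport.intro hK fun x hx => by simp [hW_def, energyFlux, hw_def, hut0 x hx]
  have hintW : Integrable (fun x => ∑ i, pd i (W i) x) :=
    integrable_finsetSum _ fun i _ => integrable_pd (hW i) (hWc i) i
  have hW0 : ∫ x, ∑ i, pd i (W i) x = 0 := by
    rw [integral_finsetSum _ fun i _ => integrable_pd (hW i) (hWc i) i]
    exact Finset.sum_eq_zero fun i _ => integral_pd_eq_zero (hW i) (hWc i) i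
  have hint2 : Integrable (fun x => ‖u t x‖ ^ 2) :=
    (hut.continuous.norm.pow 2).integrable_of_hasCompactSupport
      (HasCompactSupport.intro hK fun x hx => by simp [hut0 x hx])
  have hintr : Integrable (fun x => ‖u t x‖ ^ (r + 1)) :=
    (hut.continuous.norm.rpow_const fun _ => Or.inr (by linarith)).integrable_of_hasCompactSupport
      (HasCompactSupport.intro hK fun x hx => by
        simp [hut0 x hx, Real.zero_rpow (show r + 1 ≠ 0 by linarith)])
  have hintG : Integrable (gradSq (u t)) := by
    refine integrable_finsetSum _ fun i _ => integrable_finsetSum _ fun j _ => ?_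
    have hc : Continuous (pd i (w j)) := (ContDiff.pd (n := 1) (hw j) i).continuous
    refine (hc.pow 2).integrable_of_hasCompactSupport ?_
    simpa [pow_two] using ((hwc j).pd i).mul_left (f := pd i (w j))
  have hpt (x : E3) : deriv (fun s => ‖u s x‖ ^ 2) t
        + (3 * α / 2 - 2 * σ * y t) * ‖u t x‖ ^ 2 + 2 * μ * gradSq (u t) x
        + 2 * β * Real.exp ((r - 1) * y t) * ‖u t x‖ ^ (r + 1)
      ≤ (∑ i, pd i (W i) x) + 2 / α * Real.exp (2 * |y t|) * ‖f t x‖ ^ 2 := by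
    have hux : Differentiable ℝ (fun s => u s x) :=
      (hu.comp (contDiff_id.prodMk contDiff_const)).differentiable (by simp)
    have hD : deriv (fun s => ‖u s x‖ ^ 2) t = ∑ j, 2 * w j x * deriv (fun s => u s x j) t := by
      have hj (j : Fin 3) : HasDerivAt (fun s => u s x j) (deriv (fun s => u s x j) t) t :=
        ((differentiable_euclidean.1 hux) j t).hasDerivAt
      simp only [EuclideanSpace.real_norm_sq_eq]
      refine (HasDerivAt.fun_sum fun j _ => (hj j).pow 2).deriv.trans ?_
      simp [hw_def]
    have hpow : ‖u t x‖ ^ (r + 1) = ‖u t x‖ ^ (r - 1) * ∑ j, w j x ^ 2 := by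
      rw [show r + 1 = (r - 1) + 2 by ring, Real.rpow_add_of_nonneg (norm_nonneg _) (by linarith)
        (by norm_num), Real.rpow_two, EuclideanSpace.real_norm_sq_eq]
    have hy0 := two_exp_neg_mul_le hα (y t) (w 0 x) (f t x 0)
    have hy1 := two_exp_neg_mul_le hα (y t) (w 1 x) (f t x 1)
    have hy2 := two_exp_neg_mul_le hα (y t) (w 2 x) (f t x 2)
    have e0 := hpde t x 0
    have e1 := hpde t x 1
    have e2 := hpde t x 2
    have ed := hudiv t x
    have hlap (j : Fin 3) : lap (fun z => u t z j) x = ∑ i, pd i (pd i (w j)) x := rfl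
    have hun (j : Fin 3) : u t x j = w j x := rfl
    have hpd (i j : Fin 3) : pd i (fun z => u t z j) x = pd i (w j) x := rfl
    rw [hD, hpow, EuclideanSpace.real_norm_sq_eq (u t x), EuclideanSpace.real_norm_sq_eq (f t x)]
    simp only [hW_def, pd_energyFlux _ _ _ hw (hp t), gradSq]
    simp only [hlap, hun, hpd, Fin.sum_univ_three] at e0 e1 e2 ed ⊢
    linear_combination 2 * w 0 x * e0 + 2 * w 1 x * e1 + 2 * w 2 x * e2
      + (Real.exp (y t) * (w 0 x ^ 2 + w 1 x ^ 2 + w 2 x ^ 2)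
        + 2 * Real.exp (-(y t)) * p t x) * ed + hy0 + hy1 + hy2
  have hA := (hE t).1.fun_add (hint2.const_mul (3 * α / 2 - 2 * σ * y t))
  have hB := hA.fun_add (hintG.const_mul (2 * μ))
  have hC := hintr.const_mul (2 * β * Real.exp ((r - 1) * y t))
  have hF := (hfL2 t).const_mul (2 / α * Real.exp (2 * |y t|))
  have key := integral_mono (hB.fun_add hC) (hintW.fun_add hF) hpt
  rw [integral_add hB hC, integral_add hA (hintG.const_mul _),
    integral_add (hE t).1 (hint2.const_mul _), integral_add hintW hF, hW0] at key
  simp only [integral_const_mul, zero_add] at key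
  rw [(hE t).2.deriv]
  exact key

end
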